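/- arXiv:2011.05952 — 5 statements merged into one kernel-verified Lean document; each statement's English description precedes it below -/
import Mathlib

section
/- Let s and z be complex numbers with Re z > 1 and Re z > 1 + 2·Re s. Then Σ_{n=1}^∞ σ_s(χ₄;n²)/n^z = ((1−2^{2s−z})/(1−2^{2s−2z})) · L(χ₄, z−s)·ζ(z)·ζ(z−2s)/ζ(2z−2s). -/
open Complex Real MeasureTheory Filter Finset

noncomputable section

/-- The nontrivial Dirichlet character mod 4, extended to `ℤ`, valued in `ℂ`. -/
def chi4 (m : ℤ) : ℂ := if m % 4 = 1 then 1 else if m % 4 = 3 then -1 else 0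

/-- `σ_s(χ₄; n) = ∑_{d ∣ n} χ₄(d) d^s`. -/
def sigmaChi4 (s : ℂ) (n : ℕ) : ℂ := ∑ d ∈ n.divisors, chi4 d * (d : ℂ) ^ s

/-- `σ'_s(χ₄; n) = ∑_{d ∣ n} χ₄(d) d^s log d`. -/
def sigmaChi4' (s : ℂ) (n : ℕ) : ℂ := ∑ d ∈ n.divisors, chi4 d * (d : ℂ) ^ s * (Real.log d : ℂ)

/-- `e(x) = exp(2πix)`. -/
def e2pi (x : ℂ) : ℂ := Complex.exp (2 * (Real.pi : ℂ) * Complex.I * x)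

/-- The Dirichlet L-function of the nontrivial character mod 4. -/
def Lchi4 (s : ℂ) : ℂ :=
  DirichletCharacter.LFunction (ZMod.χ₄.ringHomComp (Int.castRingHom ℂ)) s

/-- Generalized quadratic Gauss sum `G(a, n; q)`. -/
def Gsum (a n : ℤ) (q : ℕ) : ℂ :=
  ∑ x ∈ Finset.range q, e2pi (((a * (x : ℤ) ^ 2 + n * (x : ℤ) : ℤ) : ℂ) / (q : ℂ))

/-- `K(n, l; q) = ∑_{a b ≡ 1 (mod q)} G(a,n;q) G(b,l;q)`. -/
def Ksum (n l : ℤ) (q : ℕ) : ℂ :=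
  ∑ a ∈ Finset.range q, ∑ b ∈ Finset.range q,
    if (a * b) % q = 1 % q then Gsum a n q * Gsum b l q else 0

/-- Kloosterman sum `S(m, n; c)`. -/
def kloosterman (m n : ℤ) (c : ℕ) : ℂ :=
  ∑ x ∈ Finset.range c,
    if Nat.gcd x c = 1 then
      e2pi (((m * (x : ℤ) + n * ((((x : ZMod c)⁻¹).val : ℕ) : ℤ) : ℤ) : ℂ) / (c : ℂ))
    else 0

/-- Ramanujan sum `c_C(m)`. -/
def ramanujanSum (C : ℕ) (m : ℤ) : ℂ :=
  ∑ D ∈ Finset.range C,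
    if Nat.gcd D C = 1 then e2pi (((m * (D : ℤ) : ℤ) : ℂ) / (C : ℂ)) else 0

/-- Gauss sum `g(χ₄; q; m)`. -/
def gaussChi4 (q : ℕ) (m : ℤ) : ℂ :=
  ∑ u ∈ Finset.range q,
    if Nat.gcd u q = 1 then chi4 u * e2pi (((m * (u : ℤ) : ℤ) : ℂ) / (q : ℂ)) else 0

end


lemma aux_dvd {u v u' v' : ℕ} (hu' : Squarefree u') (hv : 0 < v)
    (h : u * v ^ 2 = u' * v' ^ 2) : v ∣ v' := by
  obtain ⟨a, b, hab, ha, hb⟩ : ∃ a b : ℕ, Nat.Coprime a b ∧ v = a * v.gcd v' ∧ v' = b * v.gcd v' := by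
    obtain ⟨a, b, h1, h2, h3⟩ := Nat.exists_coprime v v'
    exact ⟨a, b, h1, h2, h3⟩
  have hg : 0 < v.gcd v' := Nat.gcd_pos_of_pos_left _ hv
  set g := v.gcd v' with hgdef
  have h2 : u * a ^ 2 = u' * b ^ 2 := by
    have : (u * a ^ 2) * g ^ 2 = (u' * b ^ 2) * g ^ 2 := by
      calc _ = u * (a * g) ^ 2 := by ring
        _ = u' * (b * g) ^ 2 := by rw [← ha, ← hb, h]
        _ = _ := by ring
    exact Nat.eq_of_mul_eq_mul_right (by positivity) this
  have h3 : a ^ 2 ∣ u' := by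
    have : a ^ 2 ∣ u' * b ^ 2 := ⟨u, by rw [← h2]; ring⟩
    exact (Nat.Coprime.pow 2 2 hab).dvd_of_dvd_mul_right this
  have h4 : a = 1 := by
    have := hu' a (by rwa [← sq])
    simpa using this
  rw [h4, one_mul] at ha
  rw [ha]; exact Nat.gcd_dvd_right _ _

lemma aux_uniq {u v u' v' : ℕ} (hu : Squarefree u) (hu' : Squarefree u') (hv : 0 < v)
    (hv' : 0 < v') (h : u * v ^ 2 = u' * v' ^ 2) : u = u' ∧ v = v' := by
  have : v = v' := Nat.dvd_antisymm (aux_dvd hu' hv h) (aux_dvd hu hv' h.symm)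
  subst this
  exact ⟨Nat.eq_of_mul_eq_mul_right (by positivity) h, rfl⟩

/-- Splitting off the square part in a sum of a completely multiplicative function. -/
lemma aux_tsum (F : ℕ →*₀ ℂ) (hF : Summable fun n => ‖F n‖) (hF2 : Summable fun n => ‖F n ^ 2‖) :
    ∑' n, F n = (∑' u : ℕ, if Squarefree u then F u else 0) * ∑' v : ℕ, F v ^ 2 := by
  let i : {u : ℕ // Squarefree u} × ℕ+ → ℕ := fun p => (p.1 : ℕ) * (p.2 : ℕ) ^ 2
  have hi : Function.Injective i := by
    rintro ⟨⟨u, hu⟩, v⟩ ⟨⟨u', hu'⟩, v'⟩ h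
    obtain ⟨h1, h2⟩ := aux_uniq hu hu' v.pos v'.pos h
    subst h1
    have := PNat.coe_injective h2
    subst this
    rfl
  have hs : Function.support F ⊆ Set.range i := by
    intro n hn
    have hn0 : 0 < n := by
      rcases Nat.eq_zero_or_pos n with rfl | h
      · simp at hn
      · exact h
    obtain ⟨a, b, ha, hb, h, hsq⟩ := Nat.sq_mul_squarefree_of_pos hn0
    exact ⟨(⟨a, hsq⟩, ⟨b, hb⟩), by simp only [i, PNat.mk_coe]; rw [← h]; ring⟩
  rw [← hi.tsum_eq hs]
  have h1 : (∑' u : ℕ, if Squarefree u then F u else 0) = ∑' u : {u : ℕ // Squarefree u}, F u := by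
    rw [show (∑' u : {u : ℕ // Squarefree u}, F u) = ∑' u : ({u : ℕ | Squarefree u} : Set ℕ), F u
      from rfl, _root_.tsum_subtype]
    refine tsum_congr fun u => ?_
    simp [Set.indicator_apply]
  have h2 : (∑' v : ℕ, F v ^ 2) = ∑' v : ℕ+, F v ^ 2 := by
    symm
    refine PNat.coe_injective.tsum_eq (f := fun v : ℕ => F v ^ 2) ?_
    intro n hn
    rcases Nat.eq_zero_or_pos n with rfl | h
    · simp at hn
    · exact ⟨⟨n, h⟩, rfl⟩
  rw [h1, h2, tsum_mul_tsum_of_summable_norm (hF.comp_injective Subtype.val_injective)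
    (hF2.comp_injective PNat.coe_injective)]
  refine tsum_congr fun p => ?_
  simp [i]

lemma aux_sigma (G : ℕ → ℂ) (hG : ∀ m n, G (m * n) = G m * G n) (n : ℕ) (hn : n ≠ 0) :
    ∑ p ∈ n.divisorsAntidiagonal, (∑ q ∈ p.1.divisorsAntidiagonal,
      (if Squarefree q.1 then G q.1 else 0) * G q.2 ^ 2) * 1 = ∑ d ∈ (n ^ 2).divisors, G d := by
  simp only [mul_one]
  rw [Nat.sum_divisorsAntidiagonal (f := fun a _ => ∑ q ∈ a.divisorsAntidiagonal,
      (if Squarefree q.1 then G q.1 else 0) * G q.2 ^ 2)]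
  simp only [ite_mul, zero_mul]
  simp only [← Finset.sum_filter]
  rw [Finset.sum_sigma']
  refine Finset.sum_nbij (fun x => x.2.1 * x.2.2 ^ 2) ?_ ?_ ?_ ?_
  · rintro ⟨a, u, v⟩ h
    simp only [Finset.mem_sigma, Nat.mem_divisors, Finset.mem_filter,
      Nat.mem_divisorsAntidiagonal] at h ⊢
    obtain ⟨⟨⟨c, rfl⟩, -⟩, ⟨rfl, h1⟩, h2⟩ := h
    exact ⟨⟨u * c ^ 2, by ring⟩, by positivity⟩
  · rintro ⟨a, u, v⟩ h ⟨a', u', v'⟩ h' heq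
    simp only [Finset.mem_coe, Finset.mem_sigma, Nat.mem_divisors, Finset.mem_filter,
      Nat.mem_divisorsAntidiagonal] at h h'
    obtain ⟨-, ⟨rfl, h1⟩, h2⟩ := h
    obtain ⟨-, ⟨rfl, h1'⟩, h2'⟩ := h'
    have hv : v ≠ 0 := fun h => h1 (by simp [h])
    have hv' : v' ≠ 0 := fun h => h1' (by simp [h])
    obtain ⟨rfl, rfl⟩ := aux_uniq h2 h2' (Nat.pos_of_ne_zero hv) (Nat.pos_of_ne_zero hv') heq
    rfl
  · intro d hd
    simp only [Finset.mem_coe, Nat.mem_divisors] at hd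
    have hd0 : 0 < d := Nat.pos_of_dvd_of_pos hd.1 (by positivity)
    obtain ⟨u, v, hu, hv, h, hsq⟩ := Nat.sq_mul_squarefree_of_pos hd0
    have hvn : v ∣ n := by
      have : v ^ 2 ∣ n ^ 2 := (Dvd.intro _ h).trans hd.1
      exact (Nat.pow_dvd_pow_iff two_ne_zero).1 this
    obtain ⟨m, rfl⟩ := hvn
    have hum : u ∣ m := by
      have h3 : v ^ 2 * u ∣ v ^ 2 * m ^ 2 := by rw [h, ← mul_pow]; exact hd.1
      have h4 : u ∣ m ^ 2 := Nat.dvd_of_mul_dvd_mul_left (by positivity) h3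
      exact (hsq.dvd_pow_iff_dvd two_ne_zero).1 h4
    obtain ⟨c, rfl⟩ := hum
    refine ⟨⟨u * v, u, v⟩, ?_, ?_⟩
    · simp only [Finset.mem_coe, Finset.mem_sigma, Nat.mem_divisors, Finset.mem_filter,
        Nat.mem_divisorsAntidiagonal]
      exact ⟨⟨⟨c, by ring⟩, hn⟩, ⟨trivial, by positivity⟩, hsq⟩
    · simp only; rw [← h]; ring
  · rintro ⟨a, u, v⟩ h
    simp only [sq, hG]

/-- The character as a Dirichlet character. -/
noncomputable def chiD : DirichletCharacter ℂ 4 := ZMod.χ₄.ringHomComp (Int.castRingHom ℂ)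

lemma chiD_natCast (n : ℕ) : chiD (n : ZMod 4) = chi4 n := by
  have h : ZMod.χ₄ (n : ZMod 4) = if n % 2 = 0 then 0 else if n % 4 = 1 then 1 else -1 :=
    ZMod.χ₄_nat_eq_if_mod_four n
  simp only [chiD, MulChar.ringHomComp_apply, h, chi4]
  have : n % 4 < 4 := Nat.mod_lt _ (by norm_num)
  split_ifs <;> first | (exfalso; omega) | simp

lemma chiD_sq : chiD * chiD = 1 := by
  have h := ZMod.isQuadratic_χ₄.sq_eq_one
  ext a
  have := DFunLike.congr_fun h (a : ZMod 4)
  simp only [sq, MulChar.mul_apply] at this ⊢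
  simp only [chiD, MulChar.ringHomComp_apply]
  rw [← map_mul, this]
  simp

lemma LSeries_chiD_sq (w : ℂ) (hw : 1 < w.re) :
    LSeries (fun n : ℕ => (chiD * chiD) n) w = riemannZeta w * (1 - (2 : ℂ) ^ (-w)) := by
  have hc : chiD * chiD = DirichletCharacter.changeLevel (one_dvd 4) (1 : DirichletCharacter ℂ 1) := by
    rw [chiD_sq, DirichletCharacter.changeLevel_one]
  rw [hc, DirichletCharacter.LSeries_changeLevel _ _ hw, DirichletCharacter.LSeries_modOne_eq,
    LSeries_one_eq_riemannZeta hw]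
  have : (4 : ℕ).primeFactors = {2} := by
    rw [show (4 : ℕ) = 2 ^ 2 by norm_num, Nat.primeFactors_prime_pow two_ne_zero Nat.prime_two]
  rw [this]
  simp [MulChar.one_apply (isUnit_of_subsingleton _)]

lemma term_shift (f : ℕ → ℂ) (a z : ℂ) (n : ℕ) :
    LSeries.term (fun n => f n * (n : ℂ) ^ a) z n = LSeries.term f (z - a) n := by
  rcases eq_or_ne n 0 with rfl | hn
  · simp
  · have : (n : ℂ) ≠ 0 := by exact_mod_cast hn
    rw [LSeries.term_of_ne_zero hn, LSeries.term_of_ne_zero hn, cpow_sub _ _ this]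
    field_simp [cpow_ne_zero_iff]

/-- Dirichlet series of `σ_s(χ₄; n²)`. -/
theorem tsum_sigmaChi4_sq (s z : ℂ) (hz : 1 < z.re) (hz2 : 1 + 2 * s.re < z.re) :
    ∑' n : ℕ+, sigmaChi4 s ((n : ℕ) ^ 2) / ((n : ℕ) : ℂ) ^ z =
      ((1 - (2 : ℂ) ^ (2 * s - z)) / (1 - (2 : ℂ) ^ (2 * s - 2 * z))) *
        (Lchi4 (z - s) * riemannZeta z * riemannZeta (z - 2 * s) /
          riemannZeta (2 * z - 2 * s)) := by
  have hw : 1 < (z - s).re := by simp; linarith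
  have hw2 : 1 < (z - 2 * s).re := by simp; linarith
  have hw3 : 1 < (2 * z - 2 * s).re := by simp; linarith
  -- the multiplicative function
  let G : ℕ → ℂ := fun n => chiD n * (n : ℂ) ^ s
  have hG : ∀ m n, G (m * n) = G m * G n := by
    intro m n
    simp only [G, Nat.cast_mul, map_mul, natCast_mul_natCast_cpow]
    ring
  let g : ℕ → ℂ := fun n => if Squarefree n then G n else 0
  let h : ℕ → ℂ := fun n => G n ^ 2
  let F := dirichletSummandHom chiD (ne_zero_of_one_lt_re hw)
  have hFn : ∀ n : ℕ, n ≠ 0 → F n = G n / (n : ℂ) ^ z := by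
    intro n hn
    have : (n : ℂ) ≠ 0 := by exact_mod_cast hn
    change chiD n * (n : ℂ) ^ (-(z - s)) = chiD n * (n : ℂ) ^ s / (n : ℂ) ^ z
    rw [neg_sub, cpow_sub _ _ this, mul_div_assoc]
  have hFsum : Summable fun n => ‖F n‖ := summable_dirichletSummand chiD hw
  have hF2eq : (fun n => F n ^ 2) = LSeries.term (fun n : ℕ => (chiD * chiD) n) (2 * z - 2 * s) := by
    ext n
    rcases eq_or_ne n 0 with rfl | hn
    · simp
    · rw [LSeries.term_of_ne_zero hn]
      change (chiD n * (n : ℂ) ^ (-(z - s))) ^ 2 = _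
      rw [show 2 * z - 2 * s = (2 : ℕ) * (z - s) by push_cast; ring, cpow_nat_mul, cpow_neg,
        MulChar.mul_apply]
      field_simp
  have hF2sum : Summable fun n => ‖F n ^ 2‖ := by
    have := (DirichletCharacter.LSeriesSummable_of_one_lt_re (chiD * chiD) hw3).norm
    rwa [← hF2eq] at this
  have key := aux_tsum F hFsum hF2sum
  have k1 : ∑' n, F n = Lchi4 (z - s) := by
    rw [tsum_dirichletSummand chiD hw, Lchi4, DirichletCharacter.LFunction_eq_LSeries _ hw]
    rfl
  have k2 : ∑' n, F n ^ 2 = riemannZeta (2 * z - 2 * s) * (1 - (2 : ℂ) ^ (2 * s - 2 * z)) := by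
    rw [hF2eq, ← neg_sub (2 * z), ← LSeries_chiD_sq _ hw3]
    rfl
  have hgterm : (fun u : ℕ => if Squarefree u then F u else 0) = LSeries.term g z := by
    ext n
    rcases eq_or_ne n 0 with rfl | hn
    · simp
    · rw [LSeries.term_of_ne_zero hn]
      simp only [g]
      split_ifs
      · exact hFn n hn
      · simp
  have hgsum : LSeriesSummable g z := by
    rw [LSeriesSummable, ← hgterm]
    refine Summable.of_norm (hFsum.of_nonneg_of_le (fun _ => norm_nonneg _) fun n => ?_)
    split_ifs <;> simp
  have hht : LSeries.term h z = LSeries.term (fun n : ℕ => (chiD * chiD) n) (z - 2 * s) := by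
    ext n
    rw [← term_shift]
    congr 1
    ext n
    simp only [h, G, MulChar.mul_apply]
    rw [show 2 * s = (2 : ℕ) * s by push_cast; ring, cpow_nat_mul]
    ring
  have hhsum : LSeriesSummable h z := by
    rw [LSeriesSummable, hht]
    exact DirichletCharacter.LSeriesSummable_of_one_lt_re (chiD * chiD) hw2
  have hh : LSeries h z = riemannZeta (z - 2 * s) * (1 - (2 : ℂ) ^ (2 * s - z)) := by
    rw [LSeries, hht, ← neg_sub z, ← LSeries_chiD_sq _ hw2]
    rfl
  have hone : LSeriesSummable 1 z := LSeriesSummable_one_iff.2 hz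
  have main : ∑' n : ℕ+, sigmaChi4 s ((n : ℕ) ^ 2) / ((n : ℕ) : ℂ) ^ z =
      LSeries (LSeries.convolution (LSeries.convolution g h) 1) z := by
    rw [LSeries, ← PNat.coe_injective.tsum_eq]
    · refine tsum_congr fun n => ?_
      rw [LSeries.term_of_ne_zero n.ne_zero]
      congr 1
      rw [LSeries.convolution_def, LSeries.convolution_def]
      have := aux_sigma G hG n n.ne_zero
      simp only [Pi.one_apply]
      rw [this, sigmaChi4]
      refine Finset.sum_congr rfl fun d _ => ?_
      simp only [G, chiD_natCast]
    · intro n hn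
      rcases Nat.eq_zero_or_pos n with rfl | h
      · simp at hn
      · exact ⟨⟨n, h⟩, rfl⟩
  rw [main, LSeries_convolution' (hgsum.convolution hhsum) hone, LSeries_convolution' hgsum hhsum,
    LSeries_one_eq_riemannZeta hz, hh]
  rw [k1, k2, hgterm] at key
  change _ = LSeries g z * _ at key
  have hne : riemannZeta (2 * z - 2 * s) * (1 - (2 : ℂ) ^ (2 * s - 2 * z)) ≠ 0 := by
    rw [← neg_sub (2 * z), ← LSeries_chiD_sq _ hw3]
    exact DirichletCharacter.LSeries_ne_zero_of_one_lt_re _ hw3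
  have hne1 := left_ne_zero_of_mul hne
  have hne2 := right_ne_zero_of_mul hne
  rw [key]
  generalize riemannZeta (2 * z - 2 * s) = A at *
  generalize (1 - (2 : ℂ) ^ (2 * s - 2 * z)) = B at *
  field_simp
end

section
/- Let q be a positive integer and a an integer with gcd(a,q)=1. Then: (i) if q is odd, G(a;q)² = q·χ₄(q); (ii) if q ≡ 2 (mod 4), G(a;q) = 0 (hence G(a;q)² = 0); (iii) if q ≡ 0 (mod 4), G(a;q)² = 2·q·i·χ₄(a). -/
open Complex Real MeasureTheory Filter Finset

/-- `e(k/q)` for integers `k`. -/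
noncomputable def EE (q : ℕ) (k : ℤ) : ℂ := e2pi ((k : ℂ) / (q : ℂ))

lemma EE_add (q : ℕ) (k l : ℤ) : EE q (k + l) = EE q k * EE q l := by
  unfold EE e2pi
  rw [← Complex.exp_add]
  congr 1
  push_cast
  ring

lemma EE_std (q : ℕ) [NeZero q] (k : ℤ) : EE q k = ZMod.stdAddChar (k : ZMod q) := by
  unfold EE e2pi
  rw [ZMod.stdAddChar_coe]
  congr 1
  ring

lemma EE_mul_self (q : ℕ) (hq : 0 < q) (k : ℤ) : EE q (q * k) = 1 := by
  have : NeZero q := ⟨hq.ne'⟩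
  rw [EE_std]
  simp

lemma EE_cancel (p q : ℕ) (hp : 0 < p) (k : ℤ) : EE (p * q) (p * k) = EE q k := by
  unfold EE
  congr 1
  push_cast
  have : (p : ℂ) ≠ 0 := by exact_mod_cast hp.ne'
  exact mul_div_mul_left _ _ this

lemma Gsum_eq (a : ℤ) (q : ℕ) : Gsum a 0 q = ∑ x ∈ Finset.range q, EE q (a * (x : ℤ) ^ 2) := by
  unfold Gsum EE
  simp

lemma sum_range_zmod (q : ℕ) [NeZero q] (f : ZMod q → ℂ) :
    ∑ x ∈ Finset.range q, f (x : ZMod q) = ∑ x : ZMod q, f x := by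
  refine Finset.sum_bij' (fun x _ => (x : ZMod q)) (fun x _ => x.val) ?_ ?_ ?_ ?_ ?_
  · intros; simp
  · intro x _
    simpa using ZMod.val_lt x
  · intro x hx
    exact ZMod.val_cast_of_lt (by simpa using hx)
  · intro x _
    simp
  · intros; rfl

lemma Gsum_zmod (a : ℤ) (q : ℕ) [NeZero q] :
    Gsum a 0 q = ∑ x : ZMod q, ZMod.stdAddChar ((a : ZMod q) * x ^ 2) := by
  rw [Gsum_eq, ← sum_range_zmod q (fun x => ZMod.stdAddChar ((a : ZMod q) * x ^ 2))]
  refine Finset.sum_congr rfl fun x _ => ?_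
  rw [EE_std]
  congr 1
  push_cast
  rfl

lemma sum_range_split (m n : ℕ) (f : ℕ → ℂ) :
    ∑ x ∈ Finset.range (m * n), f x
      = ∑ i ∈ Finset.range m, ∑ j ∈ Finset.range n, f (j + n * i) := by
  induction m with
  | zero => simp
  | succ m ih =>
    rw [Nat.succ_mul, Finset.sum_range_add, ih, Finset.sum_range_succ]
    congr 1
    refine Finset.sum_congr rfl fun x _ => ?_
    congr 1
    ring

lemma Gsum_mul (m n : ℕ) (hm : 0 < m) (hn : 0 < n) (h : m.Coprime n) (a : ℤ) :
    ∃ u v : ℤ, u * n + v * m = 1 ∧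
      Gsum a 0 (m * n) = Gsum (a * u) 0 m * Gsum (a * v) 0 n := by
  have : NeZero m := ⟨hm.ne'⟩
  have : NeZero n := ⟨hn.ne'⟩
  have : NeZero (m * n) := ⟨(Nat.mul_pos hm hn).ne'⟩
  have hc : IsCoprime (n : ℤ) (m : ℤ) := (Nat.isCoprime_iff_coprime.mpr h).symm
  obtain ⟨u, v, huv⟩ := hc
  refine ⟨u, v, huv, ?_⟩
  rw [Gsum_zmod a (m * n), Gsum_zmod _ m, Gsum_zmod _ n, Finset.sum_mul_sum,
    ← Finset.sum_product', Finset.univ_product_univ]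
  refine Fintype.sum_equiv (ZMod.chineseRemainder h).toEquiv _ _ fun x => ?_
  obtain ⟨k, rfl⟩ := ZMod.intCast_surjective x
  have e1 : ((ZMod.chineseRemainder h).toEquiv (k : ZMod (m * n))) = ((k : ZMod m), (k : ZMod n)) := by
    have : (ZMod.chineseRemainder h) (k : ZMod (m * n)) = ((k : ZMod m × ZMod n)) := map_intCast _ k
    exact this
  rw [e1]
  have h1 := EE_std (m * n) (a * k ^ 2)
  have h2 := EE_std m (a * u * k ^ 2)
  have h3 := EE_std n (a * v * k ^ 2)
  push_cast at h1 h2 h3 ⊢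
  rw [← h1, ← h2, ← h3, ← EE_cancel n m hn, ← EE_cancel m n hm, mul_comm n m, ← EE_add]
  congr 1
  linear_combination (-(a * k ^ 2)) * huv

lemma Gsum_prime (p : ℕ) (hp : p.Prime) (hodd : p ≠ 2) (a : ℤ) (ha : Int.gcd a p = 1) :
    (Gsum a 0 p) ^ 2 = (p : ℂ) * chi4 p := by
  have : Fact p.Prime := ⟨hp⟩
  have hF : ringChar (ZMod p) ≠ 2 := by rwa [ZMod.ringChar_zmod_n]
  have ha0 : (a : ZMod p) ≠ 0 := by
    intro h
    rw [ZMod.intCast_zmod_eq_zero_iff_dvd] at h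
    have := Int.gcd_eq_right_iff_dvd (by positivity) |>.mpr h
    have h2 := hp.one_lt
    omega
  set ψ : AddChar (ZMod p) ℂ := (ZMod.stdAddChar (N := p)).mulShift (a : ZMod p) with hψ
  have hprim : ψ.IsPrimitive := by
    apply AddChar.IsPrimitive.of_ne_one
    exact (ZMod.isPrimitive_stdAddChar p) ha0
  set χ : MulChar (ZMod p) ℂ := (quadraticChar (ZMod p)).ringHomComp (Int.castRingHom ℂ) with hχ
  have hq : χ.IsQuadratic := (quadraticChar_isQuadratic (ZMod p)).comp _
  have hne : χ ≠ 1 := by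
    rw [hχ, MulChar.ringHomComp_ne_one_iff (RingHom.injective_int _)]
    exact quadraticChar_ne_one hF
  have hG : Gsum a 0 p = gaussSum χ ψ := by
    rw [Gsum_zmod]
    have h1 : ∑ x : ZMod p, ZMod.stdAddChar ((a : ZMod p) * x ^ 2)
        = ∑ u : ZMod p, ∑ x ∈ Finset.univ.filter (fun x : ZMod p => x ^ 2 = u), ψ u := by
      rw [← Finset.sum_fiberwise (Finset.univ) (fun x : ZMod p => x ^ 2)]
      refine Finset.sum_congr rfl fun u _ => Finset.sum_congr rfl fun x hx => ?_
      simp only [Finset.mem_filter] at hx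
      rw [hx.2, hψ, AddChar.mulShift_apply]
    rw [h1]
    have h2 : ∀ u : ZMod p, ∑ x ∈ Finset.univ.filter (fun x : ZMod p => x ^ 2 = u), ψ u
        = χ u * ψ u + ψ u := by
      intro u
      have h3 := quadraticChar_card_sqrts hF u
      have h4 : ({x : ZMod p | x ^ 2 = u} : Set (ZMod p)).toFinset
          = Finset.univ.filter (fun x : ZMod p => x ^ 2 = u) := by
        ext; simp
      rw [h4] at h3
      rw [Finset.sum_const, nsmul_eq_mul]
      have h5 : ((Finset.univ.filter (fun x : ZMod p => x ^ 2 = u)).card : ℂ) = χ u + 1 := by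
        rw [hχ, MulChar.ringHomComp_apply]
        have h6 := congrArg (Int.cast : ℤ → ℂ) h3
        push_cast at h6
        simpa using h6
      rw [h5]; ring
    simp_rw [h2]
    rw [Finset.sum_add_distrib, AddChar.sum_eq_zero_of_ne_one, add_zero]
    · rfl
    · exact (ZMod.isPrimitive_stdAddChar p) ha0
  rw [hG, gaussSum_sq hne hq hprim, hχ, MulChar.ringHomComp_apply, quadraticChar_neg_one hF,
    ZMod.card, ZMod.χ₄_nat_eq_if_mod_four, mul_comm]
  congr 1
  have := hp.eq_two_or_odd
  unfold chi4
  have h3 : p % 4 = 1 ∨ p % 4 = 3 := by omega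
  rcases h3 with h3 | h3
  · have h4 : (p : ℤ) % 4 = 1 := by omega
    have h5 : p % 2 = 1 := by omega
    simp [h3, h4, h5]
  · have h4 : (p : ℤ) % 4 = 3 := by omega
    have h5 : p % 2 = 1 := by omega
    simp [h3, h4, h5]

lemma Gsum_sq_step (p r : ℕ) (hp : p.Prime) (hodd : p ≠ 2) (hr : 0 < r) (a : ℤ)
    (ha : Int.gcd a p = 1) :
    Gsum a 0 (p * (p * r)) = p * Gsum a 0 r := by
  have : Fact p.Prime := ⟨hp⟩
  have hp0 := hp.pos
  have ha0 : (a : ZMod p) ≠ 0 := by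
    intro h
    rw [ZMod.intCast_zmod_eq_zero_iff_dvd] at h
    have := Int.gcd_eq_right_iff_dvd (by positivity) |>.mpr h
    have h2 := hp.one_lt
    omega
  have h20 : (2 : ZMod p) ≠ 0 := by
    intro h
    have : ((2 : ℕ) : ZMod p) = 0 := by exact_mod_cast h
    rw [ZMod.natCast_eq_zero_iff] at this
    exact hodd ((Nat.prime_dvd_prime_iff_eq hp Nat.prime_two).mp this)
  rw [Gsum_eq, Gsum_eq, sum_range_split, Finset.sum_comm]
  have h1 : ∀ y ∈ Finset.range (p * r), ∑ z ∈ Finset.range p,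
      EE (p * (p * r)) (a * ((y + (p * r) * z : ℕ) : ℤ) ^ 2)
      = EE (p * (p * r)) (a * (y : ℤ) ^ 2) * if p ∣ y then (p : ℂ) else 0 := by
    intro y _
    have h2 : ∀ z ∈ Finset.range p, EE (p * (p * r)) (a * ((y + (p * r) * z : ℕ) : ℤ) ^ 2)
        = EE (p * (p * r)) (a * (y : ℤ) ^ 2) *
          (fun w : ZMod p => ZMod.stdAddChar (w * (2 * a * y : ZMod p))) (z : ZMod p) := by
      intro z _
      have h3 : a * ((y + (p * r) * z : ℕ) : ℤ) ^ 2 = a * (y : ℤ) ^ 2 +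
          ((p * r : ℕ) * (z * (2 * a * y)) + (p * (p * r) : ℕ) * (a * r * z ^ 2)) := by
        push_cast; ring
      rw [h3, EE_add, EE_add, EE_mul_self _ (by positivity), mul_one]
      congr 1
      rw [mul_comm p (p * r), EE_cancel _ _ (by positivity), EE_std]
      push_cast
      rfl
    rw [Finset.sum_congr rfl h2, ← Finset.mul_sum, sum_range_zmod p
      (fun w : ZMod p => ZMod.stdAddChar (w * (2 * a * y : ZMod p))),
      AddChar.sum_mulShift _ (ZMod.isPrimitive_stdAddChar p)]
    congr 1
    have h4 : (2 * a * y : ZMod p) = 0 ↔ p ∣ y := by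
      rw [← ZMod.natCast_eq_zero_iff]
      simp [ha0, h20]
    simp only [h4, ZMod.card]
    split_ifs <;> simp
  rw [Finset.sum_congr rfl h1, mul_comm p r, sum_range_split, Finset.mul_sum]
  refine Finset.sum_congr rfl fun w _ => ?_
  rw [Finset.sum_eq_single_of_mem 0 (by simpa using hp0)]
  · simp only [zero_add, dvd_mul_right, if_true]
    rw [mul_comm]
    congr 1
    rw [mul_comm r p, ← mul_assoc, ← EE_cancel (p * p) r (by positivity)]
    congr 1
    push_cast; ring
  · intro b hb hb0
    rw [if_neg, mul_zero]
    intro hd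
    rw [← Nat.dvd_add_iff_left (dvd_mul_right _ _)] at hd
    exact hb0 (Nat.eq_zero_of_dvd_of_lt hd (by simpa using hb))

lemma EE_two (k : ℤ) (hk : k % 2 = 1) : EE 2 k = -1 := by
  obtain ⟨l, rfl⟩ : ∃ l, k = 1 + 2 * l := ⟨k / 2, by omega⟩
  have := EE_mul_self 2 (by norm_num) l
  rw [EE_add]
  push_cast at this
  rw [this, mul_one]
  unfold EE e2pi
  rw [← Complex.exp_pi_mul_I]
  congr 1
  push_cast
  ring

lemma EE_four_one : EE 4 1 = Complex.I := by
  unfold EE e2pi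
  have : 2 * (Real.pi : ℂ) * Complex.I * (((1 : ℤ) : ℂ) / ((4 : ℕ) : ℂ))
      = (Real.pi : ℂ) / 2 * Complex.I := by
    push_cast; ring
  rw [this, Complex.exp_mul_I, Complex.cos_pi_div_two, Complex.sin_pi_div_two]
  simp

lemma EE_four (k : ℤ) (hk : k % 2 = 1) : EE 4 k = Complex.I * chi4 k := by
  have h4 : k % 4 = 1 ∨ k % 4 = 3 := by omega
  have hs : EE 4 (4 * (k / 4)) = 1 := by simpa using EE_mul_self 4 (by norm_num) (k / 4)
  rcases h4 with h | h
  · have e : k = 1 + 4 * (k / 4) := by omega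
    unfold chi4
    rw [if_pos h, e, EE_add, hs, EE_four_one]
  · have e : k = 1 + (1 + (1 + 4 * (k / 4))) := by omega
    unfold chi4
    rw [if_neg (by omega), if_pos h, e, EE_add, EE_add, EE_add, hs, EE_four_one]
    simp

lemma chi4_mul (m n : ℤ) : chi4 (m * n) = chi4 m * chi4 n := by
  have hm : m % 4 = 0 ∨ m % 4 = 1 ∨ m % 4 = 2 ∨ m % 4 = 3 := by omega
  have hn : n % 4 = 0 ∨ n % 4 = 1 ∨ n % 4 = 2 ∨ n % 4 = 3 := by omega
  unfold chi4
  rw [Int.mul_emod]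
  rcases hm with h | h | h | h <;> rcases hn with h' | h' | h' | h' <;> simp [h, h']

lemma chi4_sq (m : ℤ) (h : m % 2 = 1) : chi4 m * chi4 m = 1 := by
  have h4 : m % 4 = 1 ∨ m % 4 = 3 := by omega
  unfold chi4
  rcases h4 with h | h <;> simp [h]

lemma gcd_one_mul {a u : ℤ} {n : ℕ} (ha : Int.gcd a n = 1) (hu : Int.gcd u n = 1) :
    Int.gcd (a * u) n = 1 := by
  rw [← Int.isCoprime_iff_gcd_eq_one] at *
  exact ha.mul_left hu

lemma gcd_one_of_dvd {a : ℤ} {m n : ℕ} (ha : Int.gcd a n = 1) (h : m ∣ n) :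
    Int.gcd a m = 1 := by
  rw [← Int.isCoprime_iff_gcd_eq_one] at *
  exact ha.of_isCoprime_of_dvd_right (by exact_mod_cast h)

lemma Gsum_odd (q : ℕ) (hq : q % 2 = 1) (a : ℤ) (ha : Int.gcd a q = 1) :
    (Gsum a 0 q) ^ 2 = (q : ℂ) * chi4 q := by
  induction q using Nat.strong_induction_on generalizing a with
  | _ q ih =>
  by_cases h1 : q = 1
  · subst h1
    simp [Gsum, e2pi, chi4]
  have hp := Nat.minFac_prime h1
  set p := q.minFac with hpdef
  obtain ⟨m, hm⟩ := Nat.minFac_dvd q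
  rw [← hpdef] at hm
  have hqm : (p * m) % 2 = 1 := by rw [← hm]; exact hq
  have hpm := Nat.odd_mul.mp (Nat.odd_iff.mpr hqm)
  have hp1 := Nat.odd_iff.mp hpm.1
  have hm1 := Nat.odd_iff.mp hpm.2
  have hp2 : p ≠ 2 := by intro h; omega
  have hm0 : 0 < m := by omega
  have hap : Int.gcd a p = 1 := gcd_one_of_dvd ha (hm ▸ dvd_mul_right _ _)
  have ham : Int.gcd a m = 1 := gcd_one_of_dvd ha (hm ▸ dvd_mul_left _ _)
  have hmq : m < q := by
    rw [hm]; nlinarith [hp.one_lt]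
  clear_value p
  by_cases hd : p ∣ m
  · obtain ⟨r, rfl⟩ := hd
    have hr1 := Nat.odd_iff.mp (Nat.odd_mul.mp hpm.2).2
    have hrm : r ≤ p * r := Nat.le_mul_of_pos_left _ hp.pos
    have ihr := ih r (by omega) hr1 a (gcd_one_of_dvd ham (dvd_mul_left _ _))
    rw [hm, Gsum_sq_step p r hp hp2 (by omega) a hap, mul_pow, ihr]
    push_cast
    rw [chi4_mul, chi4_mul]
    have := chi4_sq p (by omega)
    linear_combination (-(p : ℂ) ^ 2 * r * chi4 r) * this
  · have hc : p.Coprime m := (Nat.Prime.coprime_iff_not_dvd hp).mpr hd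
    obtain ⟨u, v, huv, hG⟩ := Gsum_mul p m hp.pos hm0 hc a
    have hu : Int.gcd u p = 1 := by
      rw [← Int.isCoprime_iff_gcd_eq_one]
      exact ⟨m, v, by linarith⟩
    have hv : Int.gcd v m = 1 := by
      rw [← Int.isCoprime_iff_gcd_eq_one]
      exact ⟨p, u, by linarith⟩
    rw [hm, hG, mul_pow, Gsum_prime p hp hp2 _ (gcd_one_mul hap hu),
      ih m hmq hm1 _ (gcd_one_mul ham hv)]
    push_cast
    rw [chi4_mul]
    ring

lemma Gsum_two (m : ℕ) (hm : m % 2 = 1) (a : ℤ) (ha : a % 2 = 1) : Gsum a 0 (2 * m) = 0 := by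
  rw [Gsum_eq, sum_range_split, Finset.sum_comm]
  refine Finset.sum_eq_zero fun y _ => ?_
  rw [Finset.sum_range_succ, Finset.sum_range_one]
  have h3 : a * ((y + m * 1 : ℕ) : ℤ) ^ 2 = a * ((y + m * 0 : ℕ) : ℤ) ^ 2 +
      ((m : ℕ) * (a * m) + (2 * m : ℕ) * (a * y)) := by
    push_cast; ring
  rw [h3, EE_add, EE_add, EE_mul_self _ (by omega), mul_one, mul_comm 2 m,
    EE_cancel _ _ (by omega), EE_two]
  · ring
  · rw [Int.mul_emod, ha]; omega

lemma Gsum_two_step (s : ℕ) (hs : 0 < s) (a : ℤ) (ha : a % 2 = 1) :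
    Gsum a 0 (16 * s) = 2 * Gsum a 0 (4 * s) := by
  have key : ∀ f : ℕ → ℂ, ∑ x ∈ Finset.range (16 * s), f x
      = ∑ w ∈ Finset.range (8 * s), f (2 * w) + ∑ w ∈ Finset.range (8 * s), f (2 * w + 1) := by
    intro f
    rw [show 16 * s = 8 * s * 2 by ring, sum_range_split, ← Finset.sum_add_distrib]
    refine Finset.sum_congr rfl fun w _ => ?_
    rw [Finset.sum_range_succ, Finset.sum_range_one]
    congr 2 <;> ring
  rw [Gsum_eq, Gsum_eq, key]
  have h1 : ∑ w ∈ Finset.range (8 * s), EE (16 * s) (a * ((2 * w + 1 : ℕ) : ℤ) ^ 2) = 0 := by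
    rw [show 8 * s = 4 * (2 * s) by ring, sum_range_split, Finset.sum_comm]
    refine Finset.sum_eq_zero fun y _ => ?_
    have h2 : ∀ i : ℕ, EE (16 * s) (a * ((2 * (y + 2 * s * i) + 1 : ℕ) : ℤ) ^ 2)
        = EE (16 * s) (a * ((2 * y + 1 : ℕ) : ℤ) ^ 2) * EE 2 (a * i) := by
      intro i
      have h3 : a * ((2 * (y + 2 * s * i) + 1 : ℕ) : ℤ) ^ 2 = a * ((2 * y + 1 : ℕ) : ℤ) ^ 2 +
        ((8 * s : ℕ) * (a * i) + (16 * s : ℕ) * (a * i * y + a * s * i ^ 2)) := by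
        push_cast; ring
      rw [h3, EE_add, EE_add, EE_mul_self _ (by omega), mul_one]
      congr 1
      rw [show 16 * s = 8 * s * 2 by ring, EE_cancel _ _ (by omega)]
    simp only [h2]
    rw [← Finset.mul_sum]
    have e1 : EE 2 a = -1 := EE_two a ha
    have e0 : EE 2 0 = 1 := by simp [EE, e2pi]
    have e2 : EE 2 (a * 2) = 1 := by rw [mul_two, EE_add, e1]; norm_num
    have e3 : EE 2 (a * 3) = -1 := by
      rw [show a * 3 = a * 2 + a by ring, EE_add, e1, e2]; norm_num
    simp [Finset.sum_range_succ, e0, e1, e2, e3]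
  rw [h1, add_zero, show 8 * s = 2 * (4 * s) by ring, sum_range_split, Finset.sum_comm,
    Finset.mul_sum]
  refine Finset.sum_congr rfl fun y _ => ?_
  have h2 : ∀ i : ℕ, EE (16 * s) (a * ((2 * (y + 4 * s * i) : ℕ) : ℤ) ^ 2)
      = EE (4 * s) (a * (y : ℤ) ^ 2) := by
    intro i
    have h3 : a * ((2 * (y + 4 * s * i) : ℕ) : ℤ) ^ 2 = (4 : ℕ) * (a * (y : ℤ) ^ 2 +
        (4 * s : ℕ) * (a * i * 2 * y + a * 4 * s * i ^ 2)) := by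
      push_cast; ring
    rw [h3, show 16 * s = 4 * (4 * s) by ring, EE_cancel _ _ (by omega), EE_add,
      EE_mul_self _ (by omega), mul_one]
  simp only [h2]
  simp

lemma Gsum_pow_two (k : ℕ) (a : ℤ) (ha : a % 2 = 1) :
    (Gsum a 0 (2 ^ (k + 2))) ^ 2 = 2 * (2 ^ (k + 2) : ℂ) * Complex.I * chi4 a := by
  induction k using Nat.twoStepInduction with
  | zero =>
    have e0 : EE 4 0 = 1 := by simp [EE, e2pi]
    have e4 : EE 4 (a * 4) = 1 := by
      have := EE_mul_self 4 (by norm_num) a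
      rw [← this]; congr 1; push_cast; ring
    have e9 : EE 4 (a * 9) = EE 4 a := by
      have := EE_mul_self 4 (by norm_num) (2 * a)
      rw [← mul_one (EE 4 a), ← this, ← EE_add]; congr 1; push_cast; ring
    have hc := chi4_sq a ha
    rw [Gsum_eq]
    simp [Finset.sum_range_succ, e0, e4, e9, EE_four a ha]
    linear_combination 4 * Complex.I ^ 2 * hc + 4 * Complex.I_sq
  | one =>
    have ez : ∀ k : ℤ, EE 8 (8 * k) = 1 := fun k => by
      simpa using EE_mul_self 8 (by norm_num) k
    have es : ∀ k l : ℤ, EE 8 (k + 8 * l) = EE 8 k := fun k l => by rw [EE_add, ez, mul_one]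
    have e0 : EE 8 0 = 1 := by simp [EE, e2pi]
    have e2 : EE 8 (a * 4) = -1 := by
      rw [← EE_two a ha, ← EE_cancel 4 2 (by norm_num)]; congr 1; push_cast; ring
    have e3 : EE 8 (a * 9) = EE 8 a := by rw [← es a a]; congr 1; ring
    have e4 : EE 8 (a * 16) = 1 := by rw [← ez (2 * a)]; congr 1; ring
    have e5 : EE 8 (a * 25) = EE 8 a := by rw [← es a (3 * a)]; congr 1; ring
    have e6 : EE 8 (a * 36) = -1 := by rw [← e2, ← es (a * 4) (4 * a)]; congr 1; ring
    have e7 : EE 8 (a * 49) = EE 8 a := by rw [← es a (6 * a)]; congr 1; ring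
    have hh : EE 8 a * EE 8 a = Complex.I * chi4 a := by
      rw [← EE_four a ha, ← EE_add, ← EE_cancel 2 4 (by norm_num)]; congr 1; push_cast; ring
    rw [Gsum_eq]
    simp [Finset.sum_range_succ, e0, e2, e3, e4, e5, e6, e7]
    linear_combination 16 * hh
  | more k ih _ =>
    rw [show 2 ^ (k + 2 + 2) = 16 * 2 ^ k by ring, Gsum_two_step _ (by positivity) a ha,
      show 4 * 2 ^ k = 2 ^ (k + 2) by ring, mul_pow, ih]
    ring

lemma Gsum_four (k m : ℕ) (hm : m % 2 = 1) (a : ℤ) (ha : Int.gcd a (2 ^ (k + 2) * m : ℕ) = 1)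
    (ha2 : a % 2 = 1) :
    (Gsum a 0 (2 ^ (k + 2) * m)) ^ 2
      = 2 * ((2 ^ (k + 2) * m : ℕ) : ℂ) * Complex.I * chi4 a := by
  have hc : (2 ^ (k + 2)).Coprime m :=
    Nat.Coprime.pow_left _ ((Nat.coprime_two_left).mpr (Nat.odd_iff.mpr hm))
  obtain ⟨u, v, huv, hG⟩ := Gsum_mul (2 ^ (k + 2)) m (by positivity) (by omega) hc a
  have hv : Int.gcd v m = 1 := by
    rw [← Int.isCoprime_iff_gcd_eq_one]
    exact ⟨(2 ^ (k + 2) : ℕ), u, by linarith⟩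
  have hum : u * m % 4 = 1 := by
    have : u * m = 1 + 4 * (-(v * 2 ^ k)) := by
      push_cast at huv
      linear_combination huv
    omega
  have hu2 : u % 2 = 1 := by
    have h5 : (u * m) % 2 = 1 := by omega
    rcases Int.emod_two_eq_zero_or_one u with h | h
    · rw [Int.mul_emod, h] at h5; simp at h5
    · exact h
  have hum' : chi4 u * chi4 m = 1 := by
    rw [← chi4_mul]; simp [chi4, hum]
  rw [hG, mul_pow, Gsum_pow_two k _ (by rw [Int.mul_emod, ha2, hu2]; rfl),
    Gsum_odd m hm _ (gcd_one_mul (gcd_one_of_dvd ha (dvd_mul_left _ _)) hv), chi4_mul]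
  push_cast
  linear_combination (2 * 2 ^ (k + 2) * m * Complex.I * chi4 a) * hum'

lemma odd_of_gcd {a : ℤ} {q : ℕ} (ha : Int.gcd a q = 1) (hq : q % 2 = 0) : a % 2 = 1 := by
  have h := gcd_one_of_dvd ha (Nat.dvd_of_mod_eq_zero hq)
  rcases Int.emod_two_eq_zero_or_one a with h2 | h2
  · have := (Int.gcd_eq_right_iff_dvd (by norm_num)).mpr (Int.dvd_of_emod_eq_zero h2)
    push_cast at h
    omega
  · exact h2

/-- the square of the quadratic Gauss sum `G(a;q)`. -/
theorem Gsum_sq (q : ℕ) (hq : 0 < q) (a : ℤ) (ha : Int.gcd a q = 1) :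
    (Odd q → (Gsum a 0 q) ^ 2 = (q : ℂ) * chi4 q) ∧
    (q % 4 = 2 → Gsum a 0 q = 0) ∧
    (q % 4 = 0 → (Gsum a 0 q) ^ 2 = 2 * (q : ℂ) * Complex.I * chi4 a) := by
  refine ⟨fun h => Gsum_odd q (Nat.odd_iff.mp h) a ha, fun h => ?_, fun h => ?_⟩
  · obtain ⟨m, rfl⟩ : ∃ m, q = 2 * m := ⟨q / 2, by omega⟩
    exact Gsum_two m (by omega) a (odd_of_gcd ha (by omega))
  · obtain ⟨j, m, hm, rfl⟩ := Nat.exists_eq_two_pow_mul_odd hq.ne'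
    have hm1 := Nat.odd_iff.mp hm
    have ha2 := odd_of_gcd ha (by omega)
    match j, ha, h with
    | 0, _, h => omega
    | 1, _, h => omega
    | k + 2, ha, _ => exact Gsum_four k m hm1 a ha ha2
end

section
/- Let q be an even positive integer, a an integer with gcd(a,q)=1, and n an odd integer. If q ≡ 0 (mod 4), then G(a,n;q) = 0. If q ≡ 2 (mod 4), write q = 2r with r odd; then G(a,n;q) = 2·e(−b·n²/r)·G(2a;r), where b is any integer with 8·a·b ≡ 1 (mod r). -/
open Complex Real MeasureTheory Filter Finset

theorem aux_e2pi_add (x y : ℂ) : e2pi (x + y) = e2pi x * e2pi y := by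
  unfold e2pi
  rw [mul_add, Complex.exp_add]

theorem aux_e2pi_int (k : ℤ) : e2pi (k : ℂ) = 1 := by
  unfold e2pi
  rw [Complex.exp_eq_one_iff]
  exact ⟨k, by ring⟩

theorem aux_e2pi_half : e2pi (1 / 2) = -1 := by
  unfold e2pi
  rw [← Complex.exp_pi_mul_I]
  congr 1
  ring

theorem aux_e2pi_cast (q : ℕ) (hq : 0 < q) (m k : ℤ) :
    e2pi (((m + q * k : ℤ) : ℂ) / (q : ℂ)) = e2pi ((m : ℂ) / (q : ℂ)) := by
  have h : (q : ℂ) ≠ 0 := by exact_mod_cast hq.ne'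
  have : (((m + q * k : ℤ) : ℂ) / (q : ℂ)) = (m : ℂ) / q + (k : ℂ) := by
    push_cast
    field_simp
  rw [this, aux_e2pi_add, aux_e2pi_int, mul_one]

theorem aux_sum (r : ℕ) (hr : Odd r) (F : ℤ → ℂ) (hF : ∀ x k : ℤ, F (x + r * k) = F x) (c : ℤ) :
    ∑ x ∈ Finset.range r, F (x : ℤ) = ∑ x ∈ Finset.range r, F (2 * (x : ℤ) + c) := by
  have hr0 : (0 : ℤ) < r := by exact_mod_cast hr.pos
  have hmaps : ∀ x ∈ Finset.range r, ((2 * (x : ℤ) + c) % r).toNat ∈ Finset.range r := by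
    intro x _
    have h1 := Int.emod_nonneg (2 * (x : ℤ) + c) hr0.ne'
    have h2 := Int.emod_lt_of_pos (2 * (x : ℤ) + c) hr0
    rw [Finset.mem_range]
    omega
  have hinj : Set.InjOn (fun x : ℕ => ((2 * (x : ℤ) + c) % r).toNat) (Finset.range r : Set ℕ) := by
    intro x hx y hy hxy
    simp only [Finset.coe_range, Set.mem_Iio] at hx hy
    have h1 := Int.emod_nonneg (2 * (x : ℤ) + c) hr0.ne'
    have h2 := Int.emod_nonneg (2 * (y : ℤ) + c) hr0.ne'
    have h3 : (2 * (x : ℤ) + c) % r = (2 * (y : ℤ) + c) % r := by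
      simp only at hxy
      omega
    have h4 : (r : ℤ) ∣ 2 * ((x : ℤ) - y) := by
      have h5 := Int.ModEq.dvd (show (2 * (y : ℤ) + c) ≡ (2 * (x : ℤ) + c) [ZMOD r] from h3.symm)
      have e : 2 * ((x : ℤ) - y) = 2 * (x : ℤ) + c - (2 * (y : ℤ) + c) := by ring
      rw [e]; exact h5
    have hcop : IsCoprime (r : ℤ) 2 := by
      rw [Int.isCoprime_iff_gcd_eq_one]
      have := (Nat.coprime_two_right.mpr hr)
      exact_mod_cast this
    have h6 := hcop.dvd_of_dvd_mul_left h4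
    have h7 : (x : ℤ) - y = 0 := Int.eq_zero_of_abs_lt_dvd h6 (by rw [abs_lt]; omega)
    omega
  symm
  refine Finset.sum_nbij (fun x : ℕ => ((2 * (x : ℤ) + c) % r).toNat) hmaps hinj ?_ ?_
  · exact Finset.surjOn_of_injOn_of_card_le _ hmaps hinj le_rfl
  · intro x _
    have h1 := Int.emod_nonneg (2 * (x : ℤ) + c) hr0.ne'
    rw [Int.toNat_of_nonneg h1]
    conv_lhs => rw [← Int.emod_add_mul_ediv (2 * (x : ℤ) + c) r]
    exact hF _ _

/-- `G(a,n;q)` for `q` even and `n` odd. -/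
theorem Gsum_odd_n_even_q (q : ℕ) (hq : 0 < q) (hqe : Even q) (a : ℤ)
    (ha : Int.gcd a q = 1) (n : ℤ) (hn : Odd n) :
    (q % 4 = 0 → Gsum a n q = 0) ∧
    (q % 4 = 2 → ∀ r : ℕ, q = 2 * r → ∀ b : ℤ, 8 * a * b ≡ 1 [ZMOD (r : ℤ)] →
      Gsum a n q = 2 * e2pi (((-(b * n ^ 2) : ℤ) : ℂ) / (r : ℂ)) * Gsum (2 * a) 0 r) := by
  have hao : Odd a := by
    rw [← Int.not_even_iff_odd]
    intro h
    have h2 : (2 : ℤ) ∣ Int.gcd a q :=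
      Int.dvd_coe_gcd h.two_dvd (by exact_mod_cast hqe.two_dvd)
    rw [ha] at h2
    norm_num at h2
  constructor
  · intro h4
    obtain ⟨s, rfl⟩ : ∃ s, q = 2 * s + 2 * s := ⟨q / 4, by omega⟩
    unfold Gsum
    rw [Finset.sum_range_add, ← Finset.sum_add_distrib]
    apply Finset.sum_eq_zero
    intro x _
    obtain ⟨k, hk⟩ := hn
    have hs : (s : ℂ) ≠ 0 := by
      have : s ≠ 0 := by omega
      exact_mod_cast this
    have : (((a * ((2 * s + x : ℕ) : ℤ) ^ 2 + n * ((2 * s + x : ℕ) : ℤ) : ℤ) : ℂ) /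
        ((2 * s + 2 * s : ℕ) : ℂ)) =
        (((a * (x : ℤ) ^ 2 + n * (x : ℤ) : ℤ) : ℂ) / ((2 * s + 2 * s : ℕ) : ℂ))
        + ((a * x + a * s + k : ℤ) : ℂ) + 1 / 2 := by
      subst hk
      push_cast
      field_simp
      ring
    rw [this, aux_e2pi_add, aux_e2pi_add, aux_e2pi_int, aux_e2pi_half]
    ring
  · intro h4 r hr b hb
    subst hr
    have hro : Odd r := by rw [Nat.odd_iff]; omega
    have hr0 : 0 < r := by omega
    have hrc : (r : ℂ) ≠ 0 := by exact_mod_cast hr0.ne'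
    have hev : Even (a * r + n) := by
      have : Odd (r : ℤ) := by exact_mod_cast hro
      exact (hao.mul this).add_odd hn
    obtain ⟨t, ht⟩ := hev
    set F : ℤ → ℂ := fun x => e2pi (((a * x ^ 2 + n * x : ℤ) : ℂ) / ((2 * r : ℕ) : ℂ)) with hFd
    have hF1 : ∀ x k : ℤ, F (x + r * k) = F x := by
      intro x k
      obtain ⟨j, hj⟩ : ∃ j : ℤ, a * r * k ^ 2 + n * k = 2 * j := by
        obtain ⟨u, hu⟩ := Int.even_mul_pred_self k
        refine ⟨a * r * u + t * k, ?_⟩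
        linear_combination a * r * hu + k * ht
      have := aux_e2pi_cast (2 * r) hq (a * x ^ 2 + n * x) (a * x * k + j)
      simp only [hFd]
      rw [← this]
      congr 3
      push_cast
      linear_combination (r : ℤ) * hj
    have hG : Gsum a n (2 * r) = 2 * ∑ x ∈ Finset.range r, F (x : ℤ) := by
      have : Gsum a n (2 * r) = ∑ x ∈ Finset.range (r + r), F (x : ℤ) := by
        rw [← two_mul]; rfl
      rw [this, Finset.sum_range_add, two_mul]
      congr 1
      apply Finset.sum_congr rfl
      intro x _
      rw [← hF1 x 1]
      congr 1
      push_cast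
      ring
    rw [hG, aux_sum r hro F hF1 (-4 * b * n), mul_assoc (2 : ℂ)]
    congr 1
    unfold Gsum
    rw [Finset.mul_sum]
    apply Finset.sum_congr rfl
    intro x _
    obtain ⟨m, hm⟩ := hb.dvd
    rw [← aux_e2pi_add, ← add_div, ← Int.cast_add,
      ← aux_e2pi_cast r hr0 _ (n * m * x - b * n ^ 2 * m)]
    simp only [hFd]
    congr 1
    rw [div_eq_div_iff (by exact_mod_cast hq.ne') hrc]
    have hz : (a * (2 * (x : ℤ) + -4 * b * n) ^ 2 + n * (2 * (x : ℤ) + -4 * b * n)) =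
      2 * (-(b * n ^ 2) + (2 * a * (x : ℤ) ^ 2 + 0 * (x : ℤ)) + r * (n * m * x - b * n ^ 2 * m)) := by
      linear_combination 2 * (n * x - b * n ^ 2) * hm
    rw [hz]
    push_cast
    ring
end

section
/- Let q be an odd positive integer and n, l integers. Then K(n,l;q) = q·χ₄(q) · Σ_{a,b mod q, ab ≡ 1 (mod q)} e(−(c·b·n² + c·a·l²)/q), where c is any integer with 4·c ≡ 1 (mod q). -/
open Complex Real MeasureTheory Filter Finset

lemma e2pi_eq (q : ℕ) [NeZero q] (m : ℤ) :
    e2pi ((m : ℂ) / (q : ℂ)) = ZMod.stdAddChar (m : ZMod q) := by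
  rw [ZMod.stdAddChar_coe, e2pi]
  congr 1
  ring

/-- quadratic Gauss sum on `ZMod q` -/
noncomputable def GZ (q : ℕ) [NeZero q] (a : ZMod q) : ℂ :=
  ∑ x : ZMod q, ZMod.stdAddChar (a * x ^ 2)

lemma exists_neg_one (q : ℕ) [NeZero q] (hq : Odd q) :
    ∃ u v : ZMod q, u ^ 2 + v ^ 2 = -1 := by
  have hcop : Nat.Coprime 4 q := by
    have : Nat.Coprime (2 ^ 2) q := Nat.Coprime.pow_left 2 (Nat.coprime_two_left.mpr hq)
    simpa using this
  obtain ⟨k, hk1, hk2⟩ := Nat.chineseRemainder hcop 1 (q - 1)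
  have hq0 : 0 < q := Nat.pos_of_ne_zero (NeZero.ne q)
  have hkq : (k : ZMod q) = -1 := by
    have h := (ZMod.natCast_eq_natCast_iff _ _ _).mpr hk2
    rw [h, Nat.cast_sub hq0]; simp
  have hk4 : Nat.Coprime k 4 := by
    have : k % 4 = 1 := hk1
    rw [Nat.Coprime, Nat.gcd_comm, Nat.gcd_rec, this]
    simp
  have hkq' : Nat.Coprime k q := by
    rw [← ZMod.isUnit_iff_coprime, hkq]; exact isUnit_one.neg
  have hu : IsUnit ((k : ℕ) : ZMod (4 * q)) := by
    rw [ZMod.isUnit_iff_coprime]; exact Nat.Coprime.mul_right hk4 hkq'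
  obtain ⟨p, -, hp, hpk⟩ := Nat.forall_exists_prime_gt_and_eq_mod hu 0
  have hpk' := (ZMod.natCast_eq_natCast_iff _ _ _).mp hpk
  have h4 : p % 4 = 1 := (Nat.ModEq.of_mul_right q hpk').trans hk1
  have hpq : (p : ZMod q) = -1 := by
    rw [← hkq]
    exact (ZMod.natCast_eq_natCast_iff _ _ _).mpr (Nat.ModEq.of_mul_left 4 hpk')
  haveI := Fact.mk hp
  obtain ⟨u, v, huv⟩ := Nat.Prime.sq_add_sq (p := p) (by omega)
  refine ⟨u, v, ?_⟩
  rw [← hpq, ← huv]; push_cast; rfl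

lemma GZ_sq_neg (q : ℕ) [NeZero q] (hq : Odd q) (a : ZMod q) :
    GZ q (-a) ^ 2 = GZ q a ^ 2 := by
  obtain ⟨u, v, huv⟩ := exists_neg_one q hq
  have key : ∀ b : ZMod q, GZ q b ^ 2 =
      ∑ x : ZMod q × ZMod q, ZMod.stdAddChar (b * (x.1 ^ 2 + x.2 ^ 2)) := by
    intro b
    rw [GZ, sq, Finset.sum_mul_sum, Fintype.sum_prod_type]
    refine Finset.sum_congr rfl fun x _ => Finset.sum_congr rfl fun y _ => ?_
    rw [← AddChar.map_add_eq_mul]; congr 1; ring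
  rw [key, key]
  let E : ZMod q × ZMod q ≃ ZMod q × ZMod q :=
    { toFun := fun x => (u * x.1 - v * x.2, v * x.1 + u * x.2)
      invFun := fun x => (-(u * x.1 + v * x.2), -(-v * x.1 + u * x.2))
      left_inv := by
        rintro ⟨x, y⟩
        ext
        · simp only; linear_combination (-x) * huv
        · simp only; linear_combination (-y) * huv
      right_inv := by
        rintro ⟨x, y⟩
        ext
        · simp only; linear_combination (-x) * huv
        · simp only; linear_combination (-y) * huv }
  rw [← Equiv.sum_comp E]
  refine Finset.sum_congr rfl fun x _ => ?_
  congr 1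
  simp only [E, Equiv.coe_fn_mk]
  linear_combination (-a) * (x.1 ^ 2 + x.2 ^ 2) * huv

lemma GZ_mul_neg (q : ℕ) [NeZero q] (a t : ZMod q) (ht : 2 * a * t = 1) :
    GZ q a * GZ q (-a) = q := by
  have h1 : GZ q a * GZ q (-a) = ∑ y : ZMod q, ∑ z : ZMod q,
      ZMod.stdAddChar (a * z ^ 2) * ZMod.stdAddChar (y * (2 * a * z)) := by
    rw [mul_comm, GZ, GZ, Finset.sum_mul_sum]
    refine Finset.sum_congr rfl fun y _ => ?_
    rw [← Equiv.sum_comp (Equiv.addRight y)]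
    refine Finset.sum_congr rfl fun z _ => ?_
    rw [← AddChar.map_add_eq_mul, ← AddChar.map_add_eq_mul]; congr 1
    simp only [Equiv.coe_addRight]; ring
  rw [h1, Finset.sum_comm]
  have h2 : ∀ z : ZMod q, ∑ y : ZMod q,
      ZMod.stdAddChar (a * z ^ 2) * ZMod.stdAddChar (y * (2 * a * z))
      = if z = 0 then (q : ℂ) else 0 := by
    intro z
    rw [← Finset.mul_sum, AddChar.sum_mulShift _ (ZMod.isPrimitive_stdAddChar q)]
    have : 2 * a * z = 0 ↔ z = 0 := by
      constructor
      · intro h; linear_combination (-z) * ht + t * h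
      · rintro rfl; simp
    by_cases hz : z = 0
    · simp [hz, ZMod.card]
    · simp [hz, this]
  simp [h2]

lemma GZ_odd (q : ℕ) [NeZero q] (hq : Odd q) (a : ZMod q) :
    ∃ s : ℂ, IsIntegral ℤ s ∧ GZ q a = 1 + 2 * s := by
  obtain ⟨m, hm⟩ := hq
  refine ⟨∑ x ∈ Finset.range m, ZMod.stdAddChar (a * ((x + 1 : ℕ) : ZMod q) ^ 2), ?_, ?_⟩
  · refine IsIntegral.sum _ fun x _ => ?_
    refine IsIntegral.of_pow (n := q) (Nat.pos_of_ne_zero (NeZero.ne q)) ?_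
    rw [← AddChar.map_nsmul_eq_pow]
    simp [isIntegral_one]
  · rw [GZ, ← sum_range_zmod q (fun x => ZMod.stdAddChar (a * x ^ 2))]
    have : Finset.range q = Finset.range (m + m + 1) := by rw [hm, two_mul]
    rw [this, Finset.sum_range_succ', Finset.sum_range_add]
    have h2 : ∑ x ∈ Finset.range m, ZMod.stdAddChar (a * ((m + x + 1 : ℕ) : ZMod q) ^ 2)
        = ∑ x ∈ Finset.range m, ZMod.stdAddChar (a * ((x + 1 : ℕ) : ZMod q) ^ 2) := by
      rw [← Finset.sum_range_reflect]
      refine Finset.sum_congr rfl fun x hx => ?_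
      have hx' := Finset.mem_range.mp hx
      have : ((m + (m - 1 - x) + 1 : ℕ) : ZMod q) = -((x + 1 : ℕ) : ZMod q) := by
        rw [eq_neg_iff_add_eq_zero, ← Nat.cast_add,
          show m + (m - 1 - x) + 1 + (x + 1) = q by omega]
        simp
      rw [this, neg_sq]
    rw [h2]; simp; ring

lemma int_of_integral (N : ℤ) (w : ℂ) (hw : IsIntegral ℤ w) (h : (N : ℂ) = 4 * w) :
    (4 : ℤ) ∣ N := by
  have h1 : w = algebraMap ℚ ℂ ((N : ℚ) / 4) := by
    simp; rw [h]; ring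
  rw [h1, isIntegral_algebraMap_iff (algebraMap ℚ ℂ).injective] at hw
  obtain ⟨k, hk⟩ := IsIntegrallyClosed.isIntegral_iff.mp hw
  refine ⟨k, ?_⟩
  have : (N : ℚ) = 4 * k := by
    simp at hk; rw [hk]; ring
  exact_mod_cast this

lemma GZ_sq (q : ℕ) [NeZero q] (hq : Odd q) (a t : ZMod q) (ht : 2 * a * t = 1) :
    GZ q a ^ 2 = q * chi4 q := by
  have h1 := GZ_sq_neg q hq a
  have h2 := GZ_mul_neg q a t ht
  obtain ⟨s, hs, hG⟩ := GZ_odd q hq a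
  have h4 : (GZ q a ^ 2 - q) * (GZ q a ^ 2 + q) = 0 := by
    rw [← h2]
    linear_combination (-GZ q a ^ 2) * h1
  have hint : IsIntegral ℤ (s + s ^ 2) := hs.add (hs.pow 2)
  have hodd : q % 2 = 1 := Nat.odd_iff.mp hq
  rcases mul_eq_zero.mp h4 with h | h
  · have := int_of_integral ((q : ℤ) - 1) _ hint (by
      push_cast; rw [hG] at h; linear_combination -h)
    have h5 : (q : ℤ) % 4 = 1 := by omega
    rw [chi4, if_pos h5]; linear_combination h
  · have := int_of_integral (-(q : ℤ) - 1) _ hint (by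
      push_cast; rw [hG] at h; linear_combination -h)
    have h5 : (q : ℤ) % 4 = 3 := by omega
    rw [chi4, if_neg (by omega), if_pos h5]; linear_combination h

lemma Gsum_eq_s7 (q : ℕ) [NeZero q] (a b n c : ℤ) (hab : (a : ZMod q) * b = 1)
    (hc : 4 * (c : ZMod q) = 1) :
    Gsum a n q = ZMod.stdAddChar (-(c * b * n ^ 2) : ZMod q) * GZ q a := by
  rw [Gsum, GZ, Finset.mul_sum]
  simp only [e2pi_eq]
  push_cast
  rw [sum_range_zmod q (fun x => ZMod.stdAddChar ((a : ZMod q) * x ^ 2 + (n : ZMod q) * x)),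
    ← Equiv.sum_comp (Equiv.addRight (2 * c * b * n : ZMod q))
      (fun x => ZMod.stdAddChar (-(c * b * n ^ 2) : ZMod q) * ZMod.stdAddChar ((a : ZMod q) * x ^ 2))]
  refine Finset.sum_congr rfl fun x _ => ?_
  rw [← AddChar.map_add_eq_mul]; congr 1
  simp only [Equiv.coe_addRight]
  linear_combination (-(4 * c * n * x + 4 * c ^ 2 * b * n ^ 2) : ZMod q) * hab
    - (n * x + c * b * n ^ 2 : ZMod q) * hc

lemma GZ_inv (q : ℕ) [NeZero q] (a b : ZMod q) (hab : a * b = 1) : GZ q b = GZ q a := by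
  rw [GZ, GZ]
  let E : ZMod q ≃ ZMod q :=
    { toFun := fun x => a * x
      invFun := fun x => b * x
      left_inv := fun x => by simp only; linear_combination x * hab
      right_inv := fun x => by simp only; linear_combination x * hab }
  rw [← Equiv.sum_comp E]
  refine Finset.sum_congr rfl fun x _ => ?_
  congr 1
  simp only [E, Equiv.coe_fn_mk]
  linear_combination (a * x ^ 2) * hab

/-- `K(n,l;q)` for odd `q`. -/
theorem Ksum_odd_q (q : ℕ) (hq : 0 < q) (hqodd : Odd q) (n l : ℤ) (c : ℤ)
    (hc : 4 * c ≡ 1 [ZMOD (q : ℤ)]) :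
    Ksum n l q = (q : ℂ) * chi4 q *
      ∑ a ∈ Finset.range q, ∑ b ∈ Finset.range q,
        if (a * b) % q = 1 % q then
          e2pi (((-(c * (b : ℤ) * n ^ 2 + c * (a : ℤ) * l ^ 2) : ℤ) : ℂ) / (q : ℂ))
        else 0 := by
  haveI : NeZero q := ⟨hq.ne'⟩
  have hc' : 4 * (c : ZMod q) = 1 := by
    have := (ZMod.intCast_eq_intCast_iff _ _ _).mpr hc
    push_cast at this; exact this
  rw [Ksum, Finset.mul_sum]
  refine Finset.sum_congr rfl fun a _ => ?_
  rw [Finset.mul_sum]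
  refine Finset.sum_congr rfl fun b _ => ?_
  by_cases h : (a * b) % q = 1 % q
  · rw [if_pos h, if_pos h]
    have hab : (a : ZMod q) * b = 1 := by
      have := (ZMod.natCast_eq_natCast_iff (a * b) 1 q).mpr h
      push_cast at this; exact this
    rw [Gsum_eq_s7 q a b n c (by push_cast; exact hab) hc',
      Gsum_eq_s7 q b a l c (by push_cast; rw [mul_comm]; exact hab) hc', e2pi_eq]
    push_cast
    rw [GZ_inv q a b hab, neg_add, AddChar.map_add_eq_mul,
      ← GZ_sq q hqodd a (2 * c * b) (by linear_combination 4 * (c : ZMod q) * hab + hc')]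
    ring
  · rw [if_neg h, if_neg h, mul_zero]
end

section
/- Let q be an even positive integer and let n, l be integers such that n + l is odd (i.e., one of n, l is even and the other is odd). Then K(n,l;q) = 0. -/
open Complex Real MeasureTheory Filter Finset

theorem Gsum_aux (a n : ℤ) (h : ℕ) (hh : 0 < h) (ho : Odd (a * h + n)) :
    Gsum a n (h + h) = 0 := by
  unfold Gsum
  rw [Finset.sum_range_add, ← Finset.sum_add_distrib]
  apply Finset.sum_eq_zero
  intro x _
  obtain ⟨k, hk⟩ := ho
  have hc : (h : ℂ) ≠ 0 := by exact_mod_cast hh.ne'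
  have hk' : (a : ℂ) * h + n = 2 * k + 1 := by exact_mod_cast hk
  have key : (((a * ((h + x : ℕ) : ℤ) ^ 2 + n * ((h + x : ℕ) : ℤ) : ℤ) : ℂ)) / ((h + h : ℕ) : ℂ)
      = ((a * (x : ℤ) ^ 2 + n * (x : ℤ) : ℤ) : ℂ) / ((h + h : ℕ) : ℂ)
        + ((a * x + k : ℤ) : ℂ) + 1 / 2 := by
    have hn : (n : ℂ) = 2 * k + 1 - a * h := by rw [← hk']; ring
    push_cast
    rw [hn]
    have h2 : (h : ℂ) + h ≠ 0 := by
      rw [← two_mul]; exact mul_ne_zero two_ne_zero hc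
    field_simp
    ring
  rw [key]
  unfold e2pi
  rw [mul_add, mul_add, Complex.exp_add, Complex.exp_add]
  have e1 : Complex.exp (2 * (Real.pi : ℂ) * Complex.I * ((a * x + k : ℤ) : ℂ)) = 1 := by
    rw [Complex.exp_eq_one_iff]
    exact ⟨a * x + k, by ring⟩
  have e2 : Complex.exp (2 * (Real.pi : ℂ) * Complex.I * (1 / 2)) = -1 := by
    rw [← Complex.exp_pi_mul_I]
    congr 1
    ring
  rw [e1, e2]
  ring

/-- `K(n,l;q) = 0` for `q` even and `n + l` odd. -/
theorem Ksum_eq_zero_of_odd_add (q : ℕ) (hq : 0 < q) (hqe : Even q) (n l : ℤ)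
    (hnl : Odd (n + l)) :
    Ksum n l q = 0 := by
  obtain ⟨h, rfl⟩ := hqe
  have hh : 0 < h := by omega
  unfold Ksum
  apply Finset.sum_eq_zero
  intro a _
  apply Finset.sum_eq_zero
  intro b _
  split_ifs with hab
  · have hodd : Odd (a * b) := by
      have h2 : (a * b) ≡ 1 [MOD 2] :=
        Nat.ModEq.of_dvd (⟨h, by ring⟩ : 2 ∣ h + h) hab
      exact Nat.odd_iff.mpr h2
    obtain ⟨ha, hb⟩ := Nat.odd_mul.mp hodd
    have ha' : Odd (a : ℤ) := by exact_mod_cast ha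
    have hb' : Odd (b : ℤ) := by exact_mod_cast hb
    by_cases h1 : Odd ((a : ℤ) * h + n)
    · rw [Gsum_aux _ _ _ hh h1, zero_mul]
    · have h2 : Odd ((b : ℤ) * h + l) := by
        simp only [← Int.not_even_iff_odd, Int.even_add, Int.even_mul] at *
        tauto
      rw [Gsum_aux _ _ _ hh h2, mul_zero]
  · rfl
end
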